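/- arXiv:2108.09016 — 4 statements merged into one kernel-verified Lean document; each statement's English description precedes it below -/
import Mathlib

section
/- Let X be a measurable space and let P and Q be mutually absolutely continuous probability measures on X with density ratio r = dP/dQ satisfying 0 < r(x) < ∞ almost everywhere. Then for every measurable function T : X → ℝ, the discriminator loss E_{x∼P}[softplus(−T(x))] + E_{x∼Q}[softplus(T(x))] (with values in [0,∞]) is greater than or equal to its value at T = log r, i.e. the logit T*(x) = log (dP/dQ)(x) minimizes the softplus-activated GAN discriminator objective over all measurable logits. -/
open MeasureTheory
open scoped ENNReal

/-- The softplus activation `softplus t = log (1 + exp t)`. -/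
noncomputable def softplus (t : ℝ) : ℝ := Real.log (1 + Real.exp t)

/-- The softplus-activated GAN discriminator objective associated to a logit `T`:
`E_{x∼P}[softplus (−T x)] + E_{x∼Q}[softplus (T x)]`, valued in `[0,∞]`
(note that `softplus` is nonnegative). -/
noncomputable def ganDiscLoss {X : Type*} [MeasurableSpace X] (P Q : Measure X)
    (T : X → ℝ) : ℝ≥0∞ :=
  ∫⁻ x, ENNReal.ofReal (softplus (-(T x))) ∂P + ∫⁻ x, ENNReal.ofReal (softplus (T x)) ∂Q

lemma softplus_nonneg (t : ℝ) : 0 ≤ softplus t :=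
  Real.log_nonneg (by linarith [Real.exp_pos t])

@[fun_prop]
lemma measurable_softplus : Measurable softplus := by
  unfold softplus
  fun_prop

lemma softplus_sub_le (s t : ℝ) :
    softplus s - softplus t ≤ (Real.exp s - Real.exp t) / (1 + Real.exp t) := by
  have hs : 0 < 1 + Real.exp s := by positivity
  have ht : 0 < 1 + Real.exp t := by positivity
  calc softplus s - softplus t
      = Real.log ((1 + Real.exp s) / (1 + Real.exp t)) := (Real.log_div hs.ne' ht.ne').symm
    _ ≤ (1 + Real.exp s) / (1 + Real.exp t) - 1 := Real.log_le_sub_one_of_pos (div_pos hs ht)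
    _ = (Real.exp s - Real.exp t) / (1 + Real.exp t) := by field_simp; ring

/-- The function `t ↦ exp s * softplus (-t) + softplus t` is minimized at `t = s`. -/
lemma exp_mul_softplus_neg_add_softplus_le (s t : ℝ) :
    Real.exp s * softplus (-s) + softplus s ≤ Real.exp s * softplus (-t) + softplus t := by
  have hneg := mul_le_mul_of_nonneg_left (softplus_sub_le (-s) (-t)) (Real.exp_pos s).le
  have hpos := softplus_sub_le s t
  have hsum : Real.exp s * ((Real.exp (-s) - Real.exp (-t)) / (1 + Real.exp (-t)))
      + (Real.exp s - Real.exp t) / (1 + Real.exp t) = 0 := by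
    have hs := Real.exp_pos s
    have ht := Real.exp_pos t
    rw [Real.exp_neg, Real.exp_neg]
    field_simp
    ring
  linarith

/-- The discriminator objective as a single integral against `Q`. -/
lemma ganDiscLoss_eq_lintegral {X : Type*} [MeasurableSpace X] {P Q : Measure X}
    [SigmaFinite P] [SigmaFinite Q] (hPQ : P ≪ Q) {T : X → ℝ} (hT : Measurable T) :
    ganDiscLoss P Q T = ∫⁻ x, (P.rnDeriv Q x * ENNReal.ofReal (softplus (-(T x)))
      + ENNReal.ofReal (softplus (T x))) ∂Q := by
  rw [ganDiscLoss, lintegral_add_right _ (by fun_prop),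
    lintegral_rnDeriv_mul hPQ (by fun_prop)]

/-- The logit `T⋆ = log (dP/dQ)` minimizes the softplus-activated GAN discriminator
objective over all measurable logits, for mutually absolutely continuous probability
measures `P, Q` whose density ratio is a.e. positive and finite. -/
theorem log_rnDeriv_minimizes_softplus_gan_loss
    {X : Type*} [MeasurableSpace X] (P Q : Measure X)
    [IsProbabilityMeasure P] [IsProbabilityMeasure Q]
    (hPQ : P ≪ Q) (hQP : Q ≪ P)
    (hr : ∀ᵐ x ∂Q, 0 < P.rnDeriv Q x ∧ P.rnDeriv Q x < ∞) :
    ∀ T : X → ℝ, Measurable T →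
      ganDiscLoss P Q (fun x => Real.log ((P.rnDeriv Q x).toReal)) ≤ ganDiscLoss P Q T := by
  intro T hT
  rw [ganDiscLoss_eq_lintegral hPQ (Measure.measurable_rnDeriv P Q).ennreal_toReal.log,
    ganDiscLoss_eq_lintegral hPQ hT]
  refine lintegral_mono_ae ?_
  filter_upwards [hr] with x ⟨hpos, hfin⟩
  have hr_pos : 0 < (P.rnDeriv Q x).toReal := ENNReal.toReal_pos hpos.ne' hfin.ne
  have integrand_eq (u : ℝ) : P.rnDeriv Q x * ENNReal.ofReal (softplus (-u))
      + ENNReal.ofReal (softplus u)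
      = ENNReal.ofReal ((P.rnDeriv Q x).toReal * softplus (-u) + softplus u) := by
    rw [ENNReal.ofReal_add (mul_nonneg hr_pos.le (softplus_nonneg _)) (softplus_nonneg _),
      ENNReal.ofReal_mul hr_pos.le, ENNReal.ofReal_toReal hfin.ne]
  rw [integrand_eq, integrand_eq]
  refine ENNReal.ofReal_le_ofReal ?_
  have hmin := exp_mul_softplus_neg_add_softplus_le (Real.log (P.rnDeriv Q x).toReal) (T x)
  rwa [Real.exp_log hr_pos] at hmin
end

section
/- (Proposition 2) Let Y = {1,…,K} be a finite label set and X a measurable space. Let P_XY = P_X ⊗ κ_P (the real joint distribution) and Q_XY = Q_X ⊗ κ_Q (the generated joint distribution) be probability measures on X × Y, where κ_P and κ_Q are Markov kernels from X to Y with strictly positive conditional probabilities, and assume Q_X ≪ P_X. Suppose the classifiers C^p and C^q optimally minimize their cross-entropy losses, i.e. C^p(x) = κ_P(x) for P_X-almost every x and C^q(x) = κ_Q(x) for Q_X-almost every x. Then the difference of the two cross-entropy losses evaluated on generated data equals the expected reverse KL divergence between the real and generated label conditionals: E_{(x,y)∼Q_XY}[−log C^p(x)({y})] − E_{(x,y)∼Q_XY}[−log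 C^q(x)({y})] = E_{x∼Q_X}[ KL(κ_Q(x) ‖ κ_P(x)) ]. -/
open MeasureTheory ProbabilityTheory
open scoped ENNReal Classical

/-- The extended negative logarithm of a probability `p ∈ [0,1]` (in `ℝ≥0∞`), with
`negLog 0 = ∞`. -/
noncomputable def negLog (p : ℝ≥0∞) : ℝ≥0∞ :=
  if p = 0 then ⊤ else ENNReal.ofReal (-(Real.log p.toReal))

/-- The cross-entropy loss `E_{(x,y)∼R_X ⊗ κ}[−log C(x)({y})]` of a classifier
(Markov kernel) `C` on the joint distribution `R_X ⊗ κ`, valued in `[0,∞]`. -/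
noncomputable def crossEnt {X : Type*} [MeasurableSpace X] {K : ℕ}
    (R : Measure X) (κ C : Kernel X (Fin K)) : ℝ≥0∞ :=
  ∫⁻ p, negLog (C p.1 {p.2}) ∂(R ⊗ₘ κ)

/-- The Kullback–Leibler divergence between probability measures on the finite label
set `Fin K`: `KL(μ ‖ ν) = Σ_y μ{y} log (μ{y}/ν{y})` when `μ ≪ ν` and `+∞` otherwise. -/
noncomputable def klFin {K : ℕ} (μ ν : Measure (Fin K)) : ℝ≥0∞ :=
  if μ ≪ ν
  then ENNReal.ofReal
    (∑ y : Fin K, (μ {y}).toReal * Real.log ((μ {y}).toReal / (ν {y}).toReal))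
  else ⊤

lemma measurable_negLog : Measurable negLog := by
  unfold negLog
  exact Measurable.ite (measurableSet_singleton 0) measurable_const (by fun_prop)

lemma negLog_eq_ofReal {p : ℝ≥0∞} (hp : 0 < p) :
    negLog p = ENNReal.ofReal (-Real.log p.toReal) :=
  if_neg hp.ne'

lemma measurable_negLog_kernel {X : Type*} [MeasurableSpace X] {K : ℕ}
    (C : Kernel X (Fin K)) (y : Fin K) : Measurable fun x => negLog (C x {y}) :=
  measurable_negLog.comp (C.measurable_coe (measurableSet_singleton y))

lemma crossEnt_eq_lintegral_sum {X : Type*} [MeasurableSpace X] {K : ℕ}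
    (ρ : Measure X) [SFinite ρ] (κ C : Kernel X (Fin K)) [IsSFiniteKernel κ] :
    crossEnt ρ κ C = ∫⁻ x, ∑ y, negLog (C x {y}) * κ x {y} ∂ρ := by
  have h : Measurable fun p : X × Fin K => negLog (C p.1 {p.2}) :=
    measurable_from_prod_countable_left (measurable_negLog_kernel C)
  simp [crossEnt, Measure.lintegral_compProd h, lintegral_fintype]

lemma sum_toReal_measure_singleton {K : ℕ} (μ : Measure (Fin K)) [IsProbabilityMeasure μ] :
    ∑ y, (μ {y}).toReal = 1 := by
  rw [← ENNReal.toReal_sum fun y _ => measure_ne_top μ {y}, sum_measure_singleton]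
  simp

lemma neg_log_toReal_measure_nonneg {α : Type*} [MeasurableSpace α] (μ : Measure α)
    [IsProbabilityMeasure μ] (s : Set α) : 0 ≤ -Real.log (μ s).toReal :=
  neg_nonneg.2 (Real.log_nonpos ENNReal.toReal_nonneg measureReal_le_one)

lemma sum_negLog_mul_eq_ofReal {K : ℕ} (μ ν : Measure (Fin K)) [IsProbabilityMeasure μ]
    [IsProbabilityMeasure ν] (hν : ∀ y, 0 < ν {y}) :
    ∑ y, negLog (ν {y}) * μ {y}
      = ENNReal.ofReal (∑ y, -Real.log (ν {y}).toReal * (μ {y}).toReal) := by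
  rw [ENNReal.ofReal_sum_of_nonneg fun y _ =>
    mul_nonneg (neg_log_toReal_measure_nonneg ν {y}) ENNReal.toReal_nonneg]
  refine Finset.sum_congr rfl fun y _ => ?_
  rw [negLog_eq_ofReal (hν y), ENNReal.ofReal_mul (neg_log_toReal_measure_nonneg ν {y}),
    ENNReal.ofReal_toReal (measure_ne_top μ {y})]

/-- Gibbs' inequality on a finite label set. -/
lemma sum_mul_log_div_nonneg {K : ℕ} (μ ν : Measure (Fin K)) [IsProbabilityMeasure μ]
    [IsProbabilityMeasure ν] (hμ : ∀ y, 0 < μ {y}) (hν : ∀ y, 0 < ν {y}) :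
    0 ≤ ∑ y, (μ {y}).toReal * Real.log ((μ {y}).toReal / (ν {y}).toReal) := by
  have h : ∀ y ∈ Finset.univ, (μ {y}).toReal - (ν {y}).toReal
      ≤ (μ {y}).toReal * Real.log ((μ {y}).toReal / (ν {y}).toReal) := fun y _ => by
    have hm := ENNReal.toReal_pos (hμ y).ne' (measure_ne_top μ {y})
    have hn := ENNReal.toReal_pos (hν y).ne' (measure_ne_top ν {y})
    have hlog := Real.one_sub_inv_le_log_of_pos (div_pos hm hn)
    calc (μ {y}).toReal - (ν {y}).toReal
        = (μ {y}).toReal * (1 - ((μ {y}).toReal / (ν {y}).toReal)⁻¹) := by field_simp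
      _ ≤ _ := mul_le_mul_of_nonneg_left hlog hm.le
  simpa [Finset.sum_sub_distrib, sum_toReal_measure_singleton] using Finset.sum_le_sum h

lemma sum_negLog_mul_eq_add_klFin {K : ℕ} (μ ν : Measure (Fin K)) [IsProbabilityMeasure μ]
    [IsProbabilityMeasure ν] (hμ : ∀ y, 0 < μ {y}) (hν : ∀ y, 0 < ν {y}) :
    ∑ y, negLog (ν {y}) * μ {y} = ∑ y, negLog (μ {y}) * μ {y} + klFin μ ν := by
  have hac : μ ≪ ν := fun s hs => by
    have : s = ∅ := Set.eq_empty_of_forall_notMem fun y hy =>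
      (hν y).ne' (measure_mono_null (Set.singleton_subset_iff.2 hy) hs)
    simp [this]
  rw [klFin, if_pos hac, sum_negLog_mul_eq_ofReal μ ν hν, sum_negLog_mul_eq_ofReal μ μ hμ,
    ← ENNReal.ofReal_add (Finset.sum_nonneg fun y _ =>
      mul_nonneg (neg_log_toReal_measure_nonneg μ {y}) ENNReal.toReal_nonneg)
      (sum_mul_log_div_nonneg μ ν hμ hν), ← Finset.sum_add_distrib]
  congr 1
  refine Finset.sum_congr rfl fun y _ => ?_
  rw [Real.log_div (ENNReal.toReal_pos (hμ y).ne' (measure_ne_top μ {y})).ne'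
    (ENNReal.toReal_pos (hν y).ne' (measure_ne_top ν {y})).ne']
  ring

lemma sum_negLog_mul_self_le {K : ℕ} (μ : Measure (Fin K)) [IsProbabilityMeasure μ]
    (hμ : ∀ y, 0 < μ {y}) : ∑ y, negLog (μ {y}) * μ {y} ≤ K := by
  rw [sum_negLog_mul_eq_ofReal μ μ hμ]
  refine ENNReal.ofReal_le_of_le_toReal ?_
  have h : ∀ y ∈ Finset.univ, -Real.log (μ {y}).toReal * (μ {y}).toReal ≤ 1 := fun y _ => by
    have hm := ENNReal.toReal_pos (hμ y).ne' (measure_ne_top μ {y})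
    have hlog := Real.one_sub_inv_le_log_of_pos hm
    calc -Real.log (μ {y}).toReal * (μ {y}).toReal
        ≤ ((μ {y}).toReal⁻¹ - 1) * (μ {y}).toReal :=
          mul_le_mul_of_nonneg_right (by linarith) hm.le
      _ = 1 - (μ {y}).toReal := by field_simp
      _ ≤ 1 := by linarith
  simpa using Finset.sum_le_sum h

lemma crossEnt_self_ne_top {X : Type*} [MeasurableSpace X] {K : ℕ} (ρ : Measure X)
    [IsFiniteMeasure ρ] (κ : Kernel X (Fin K)) [IsMarkovKernel κ]
    (hκ : ∀ᵐ x ∂ρ, ∀ y, 0 < κ x {y}) : crossEnt ρ κ κ ≠ ⊤ := by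
  rw [crossEnt_eq_lintegral_sum]
  refine ((lintegral_mono_ae (hκ.mono fun x hx => sum_negLog_mul_self_le (κ x) hx)).trans_lt
    ?_).ne
  rw [lintegral_const]
  exact ENNReal.mul_lt_top (ENNReal.natCast_lt_top K) (measure_lt_top ρ _)

lemma crossEnt_congr_ae {X : Type*} [MeasurableSpace X] {K : ℕ} (ρ : Measure X) [SFinite ρ]
    (κ : Kernel X (Fin K)) [IsSFiniteKernel κ] {C D : Kernel X (Fin K)}
    (h : ∀ᵐ x ∂ρ, C x = D x) : crossEnt ρ κ C = crossEnt ρ κ D := by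
  rw [crossEnt_eq_lintegral_sum, crossEnt_eq_lintegral_sum]
  exact lintegral_congr_ae (h.mono fun x hx => by simp only [hx])

lemma crossEnt_eq_add_lintegral_klFin {X : Type*} [MeasurableSpace X] {K : ℕ} (ρ : Measure X)
    [SFinite ρ] (κ η : Kernel X (Fin K)) [IsMarkovKernel κ] [IsMarkovKernel η]
    (hκ : ∀ᵐ x ∂ρ, ∀ y, 0 < κ x {y}) (hη : ∀ᵐ x ∂ρ, ∀ y, 0 < η x {y}) :
    crossEnt ρ κ η = crossEnt ρ κ κ + ∫⁻ x, klFin (κ x) (η x) ∂ρ := by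
  have hmeas : Measurable fun x => ∑ y, negLog (κ x {y}) * κ x {y} :=
    Finset.measurable_sum _ fun y _ =>
      (measurable_negLog_kernel κ y).mul (κ.measurable_coe (measurableSet_singleton y))
  rw [crossEnt_eq_lintegral_sum, crossEnt_eq_lintegral_sum, ← lintegral_add_left hmeas]
  refine lintegral_congr_ae ?_
  filter_upwards [hκ, hη] with x hx hx'
  exact sum_negLog_mul_eq_add_klFin (κ x) (η x) hx hx'

/-- Proposition 2: if the classifiers `C^p` and `C^q` are optimal (`C^p = κ_P` a.e. `P_X`
and `C^q = κ_Q` a.e. `Q_X`), then the difference of their cross-entropy losses on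
generated data `Q_XY = Q_X ⊗ κ_Q` equals the expected reverse KL divergence
`E_{x∼Q_X}[KL(κ_Q(x) ‖ κ_P(x))]`. -/
theorem crossEnt_diff_eq_expected_reverse_kl
    {X : Type*} [MeasurableSpace X] {K : ℕ}
    (P Q : Measure X) [IsProbabilityMeasure P] [IsProbabilityMeasure Q]
    (κP κQ : Kernel X (Fin K)) [IsMarkovKernel κP] [IsMarkovKernel κQ]
    (hposP : ∀ᵐ x ∂P, ∀ y : Fin K, 0 < κP x {y})
    (hposQ : ∀ᵐ x ∂Q, ∀ y : Fin K, 0 < κQ x {y})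
    (hQP : Q ≪ P)
    (Cp Cq : Kernel X (Fin K)) [IsMarkovKernel Cp] [IsMarkovKernel Cq]
    (hCp : ∀ᵐ x ∂P, Cp x = κP x) (hCq : ∀ᵐ x ∂Q, Cq x = κQ x) :
    ((crossEnt Q κQ Cp : ℝ≥0∞) : EReal) - ((crossEnt Q κQ Cq : ℝ≥0∞) : EReal)
      = ((∫⁻ x, klFin (κQ x) (κP x) ∂Q : ℝ≥0∞) : EReal) := by
  rw [crossEnt_congr_ae Q κQ (hQP.ae_le hCp), crossEnt_congr_ae Q κQ hCq,
    crossEnt_eq_add_lintegral_klFin Q κQ κP hposQ (hQP.ae_le hposP), EReal.coe_ennreal_add,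
    add_comm]
  lift crossEnt Q κQ κQ to NNReal using crossEnt_self_ne_top Q κQ hposQ with a
  exact EReal.add_sub_cancel_right (b := (a : ℝ))
end

section
/- Let X be a measurable space and Y = {1,…,K} a finite label set. Let P_XY = P_X ⊗ κ_P and Q_XY = Q_X ⊗ κ_Q be probability measures on X × Y, and let κ_p and κ_q be any two further Markov kernels from X to Y (the classifiers' induced conditionals Q^p_{Y|X} and Q^q_{Y|X}). Then the total variation distance between the joints is bounded by δ(P_XY, Q_XY) ≤ δ(P_X, Q_X) + E_{x∼Q_X}[δ(κ_P(x), κ_p(x))] + E_{x∼Q_X}[δ(κ_p(x), κ_q(x))] + E_{x∼Q_X}[δ(κ_q(x), κ_Q(x))]; i.e. the joint mismatch is controlled by the marginal mismatch (enforced by the unconditional GAN), the classifiers' disagreement (the f-divergence term), and the two cross-entropy approximation errors. -/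
open MeasureTheory ProbabilityTheory
open scoped ENNReal

/-- The total variation distance between two measures:
`δ(μ, ν) = sup { |μ(A) − ν(A)| : A measurable }`. -/
noncomputable def tvDist {α : Type*} [MeasurableSpace α] (μ ν : Measure α) : ℝ :=
  ⨆ A : {A : Set α // MeasurableSet A}, |(μ A.1).toReal - (ν A.1).toReal|

section TotalVariation

variable {α : Type*} [MeasurableSpace α]

theorem abs_measureReal_sub_le_one (μ ν : Measure α) [IsProbabilityMeasure μ]
    [IsProbabilityMeasure ν] (A : Set α) : |(μ A).toReal - (ν A).toReal| ≤ 1 := by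
  have h₁ : (μ A).toReal ≤ 1 := measureReal_le_one
  have h₂ : (ν A).toReal ≤ 1 := measureReal_le_one
  have h₃ : 0 ≤ (μ A).toReal := ENNReal.toReal_nonneg
  have h₄ : 0 ≤ (ν A).toReal := ENNReal.toReal_nonneg
  rw [abs_le]
  constructor <;> linarith

theorem abs_measureReal_sub_le_tvDist (μ ν : Measure α) [IsProbabilityMeasure μ]
    [IsProbabilityMeasure ν] {A : Set α} (hA : MeasurableSet A) :
    |(μ A).toReal - (ν A).toReal| ≤ tvDist μ ν :=
  le_ciSup (f := fun A : {A : Set α // MeasurableSet A} ↦ |(μ A.1).toReal - (ν A.1).toReal|)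
    ⟨1, by rintro _ ⟨B, rfl⟩; exact abs_measureReal_sub_le_one μ ν B.1⟩ ⟨A, hA⟩

theorem tvDist_le_of_forall {μ ν : Measure α} {c : ℝ}
    (h : ∀ A, MeasurableSet A → |(μ A).toReal - (ν A).toReal| ≤ c) : tvDist μ ν ≤ c :=
  have : Nonempty {A : Set α // MeasurableSet A} := ⟨⟨∅, .empty⟩⟩
  ciSup_le fun A ↦ h A.1 A.2

theorem tvDist_nonneg (μ ν : Measure α) : 0 ≤ tvDist μ ν :=
  Real.iSup_nonneg fun _ ↦ abs_nonneg _

theorem tvDist_le_one (μ ν : Measure α) [IsProbabilityMeasure μ] [IsProbabilityMeasure ν] :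
    tvDist μ ν ≤ 1 :=
  tvDist_le_of_forall fun A _ ↦ abs_measureReal_sub_le_one μ ν A

/-- Integrals of a `[0, 1]`-valued function against two probability measures differ by at most
their total variation distance. -/
theorem abs_integral_sub_integral_le_tvDist (μ ν : Measure α) [IsProbabilityMeasure μ]
    [IsProbabilityMeasure ν] {f : α → ℝ} (hf : Measurable f) (h0 : ∀ x, 0 ≤ f x)
    (h1 : ∀ x, f x ≤ 1) : |∫ x, f x ∂μ - ∫ x, f x ∂ν| ≤ tvDist μ ν := by
  have layer (ρ : Measure α) [IsProbabilityMeasure ρ] :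
      ∫ x, f x ∂ρ = ∫ t in Set.Ioc (0 : ℝ) 1, ρ.real {x | t ≤ f x} :=
    Integrable.integral_eq_integral_Ioc_meas_le
      (.of_bound hf.aestronglyMeasurable 1 (.of_forall fun x ↦ by
        rw [Real.norm_of_nonneg (h0 x)]; exact h1 x))
      (.of_forall h0) (.of_forall h1)
  have anti (ρ : Measure α) [IsProbabilityMeasure ρ] :
      Antitone fun t ↦ ρ.real {x | t ≤ f x} :=
    fun _ _ hst ↦ measureReal_mono fun _ hx ↦ hst.trans hx
  have integrable (ρ : Measure α) [IsProbabilityMeasure ρ] :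
      IntegrableOn (fun t ↦ ρ.real {x | t ≤ f x}) (Set.Ioc (0 : ℝ) 1) :=
    .of_bound (by simp) (anti ρ).measurable.aestronglyMeasurable 1 (.of_forall fun t ↦ by
      rw [Real.norm_of_nonneg measureReal_nonneg]; exact measureReal_le_one)
  rw [layer μ, layer ν, ← integral_sub (integrable μ) (integrable ν), ← Real.norm_eq_abs]
  refine (norm_setIntegral_le_of_norm_le_const (C := tvDist μ ν) (by simp) fun t _ ↦ ?_).trans
    (by simp)
  exact abs_measureReal_sub_le_tvDist μ ν (measurableSet_le measurable_const hf)

variable {β : Type*} [MeasurableSpace β]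

theorem toReal_compProd_apply (μ : Measure α) [IsProbabilityMeasure μ] (κ : Kernel α β)
    [IsMarkovKernel κ] {A : Set (α × β)} (hA : MeasurableSet A) :
    ((μ ⊗ₘ κ) A).toReal = ∫ x, (κ x (Prod.mk x ⁻¹' A)).toReal ∂μ := by
  rw [Measure.compProd_apply hA, integral_toReal
    (Kernel.measurable_kernel_prodMk_left hA).aemeasurable (.of_forall fun _ ↦ measure_lt_top _ _)]

theorem integrable_tvDist [Finite β] (μ : Measure α) [IsProbabilityMeasure μ]
    (κ η : Kernel α β) [IsMarkovKernel κ] [IsMarkovKernel η] :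
    Integrable (fun x ↦ tvDist (κ x) (η x)) μ := by
  have meas : Measurable fun x ↦ tvDist (κ x) (η x) :=
    Measurable.iSup fun A ↦ ((κ.measurable_coe A.2).ennreal_toReal.sub
      (η.measurable_coe A.2).ennreal_toReal).abs
  exact .of_bound meas.aestronglyMeasurable 1 (.of_forall fun x ↦ by
    rw [Real.norm_of_nonneg (tvDist_nonneg _ _)]; exact tvDist_le_one _ _)

theorem tvDist_triangle (μ ν ρ : Measure α) [IsProbabilityMeasure μ] [IsProbabilityMeasure ν]
    [IsProbabilityMeasure ρ] : tvDist μ ρ ≤ tvDist μ ν + tvDist ν ρ :=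
  tvDist_le_of_forall fun _ hA ↦ (abs_sub_le _ _ _).trans
    (add_le_add (abs_measureReal_sub_le_tvDist μ ν hA) (abs_measureReal_sub_le_tvDist ν ρ hA))

theorem tvDist_compProd_left_le (μ ν : Measure α) [IsProbabilityMeasure μ]
    [IsProbabilityMeasure ν] (κ : Kernel α β) [IsMarkovKernel κ] :
    tvDist (μ ⊗ₘ κ) (ν ⊗ₘ κ) ≤ tvDist μ ν :=
  tvDist_le_of_forall fun A hA ↦ by
    rw [toReal_compProd_apply μ κ hA, toReal_compProd_apply ν κ hA]
    exact abs_integral_sub_integral_le_tvDist μ ν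
      (Kernel.measurable_kernel_prodMk_left hA).ennreal_toReal
      (fun _ ↦ ENNReal.toReal_nonneg) (fun _ ↦ measureReal_le_one)

theorem tvDist_compProd_right_le [Finite β] (μ : Measure α) [IsProbabilityMeasure μ]
    (κ η : Kernel α β) [IsMarkovKernel κ] [IsMarkovKernel η] :
    tvDist (μ ⊗ₘ κ) (μ ⊗ₘ η) ≤ ∫ x, tvDist (κ x) (η x) ∂μ :=
  tvDist_le_of_forall fun A hA ↦ by
    have integrable (ξ : Kernel α β) [IsMarkovKernel ξ] :
        Integrable (fun x ↦ (ξ x (Prod.mk x ⁻¹' A)).toReal) μ :=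
      .of_bound (Kernel.measurable_kernel_prodMk_left hA).ennreal_toReal.aestronglyMeasurable 1
        (.of_forall fun x ↦ by
          rw [Real.norm_of_nonneg ENNReal.toReal_nonneg]; exact measureReal_le_one)
    rw [toReal_compProd_apply μ κ hA, toReal_compProd_apply μ η hA,
      ← integral_sub (integrable κ) (integrable η), ← Real.norm_eq_abs]
    exact norm_integral_le_of_norm_le (integrable_tvDist μ κ η) (.of_forall fun x ↦
      abs_measureReal_sub_le_tvDist (κ x) (η x) (measurable_prodMk_left hA))

end TotalVariation

/-- The total variation distance between the joints `P_XY = P_X ⊗ κ_P` and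
`Q_XY = Q_X ⊗ κ_Q` is controlled by the marginal mismatch, the two classifiers'
(kernels `κ_p`, `κ_q`) disagreement, and the two cross-entropy approximation errors:
`δ(P_XY, Q_XY) ≤ δ(P_X, Q_X) + E_{x∼Q_X}[δ(κ_P(x), κ_p(x))]
  + E_{x∼Q_X}[δ(κ_p(x), κ_q(x))] + E_{x∼Q_X}[δ(κ_q(x), κ_Q(x))]`. -/
theorem tvDist_joint_le_marginal_add_conditionals
    {X : Type*} [MeasurableSpace X] {K : ℕ}
    (P Q : Measure X) [IsProbabilityMeasure P] [IsProbabilityMeasure Q]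
    (κP κQ κp κq : Kernel X (Fin K))
    [IsMarkovKernel κP] [IsMarkovKernel κQ] [IsMarkovKernel κp] [IsMarkovKernel κq] :
    tvDist (P ⊗ₘ κP) (Q ⊗ₘ κQ)
      ≤ tvDist P Q + ∫ x, tvDist (κP x) (κp x) ∂Q
        + ∫ x, tvDist (κp x) (κq x) ∂Q + ∫ x, tvDist (κq x) (κQ x) ∂Q := by
  have h₁ := tvDist_triangle (P ⊗ₘ κP) (Q ⊗ₘ κP) (Q ⊗ₘ κQ)
  have h₂ := tvDist_triangle (Q ⊗ₘ κP) (Q ⊗ₘ κp) (Q ⊗ₘ κQ)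
  have h₃ := tvDist_triangle (Q ⊗ₘ κp) (Q ⊗ₘ κq) (Q ⊗ₘ κQ)
  linarith [tvDist_compProd_left_le P Q κP, tvDist_compProd_right_le Q κP κp,
    tvDist_compProd_right_le Q κp κq, tvDist_compProd_right_le Q κq κQ]
end

section
/- (Theorem 1) Let X be a measurable space and Y = {1,…,K} a finite label set. Let P_XY = P_X ⊗ κ_P be the real data distribution and Q_XY = Q_X ⊗ κ_Q the distribution induced by the generator G, both probability measures on X × Y, and let κ_p and κ_q be Markov kernels from X to Y (the conditionals Q^p_{Y|X} and Q^q_{Y|X} induced by the two auxiliary classifiers). Then the Jensen–Shannon divergence between the joints is bounded as JSD(P_XY, Q_XY) ≤ 2·c₁·√(2·JSD(P_X, Q_X)) + c₂·√(2·E_{x∼Q_X}[KL(κ_P(x) ‖ κ_p(x))]) + c₂·√(2·E_{x∼Q_X}[KL(κ_Q(x) ‖ κ_q(x))]) + c₂·√(2·E_{x∼Q_X}[KL(κ_q(x) ‖ κ_p(x))]), where c₁ = c₂ = 1 suffices (these constants upper-bound the total masses of the probability kernels and marginals involved). -/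
open MeasureTheory ProbabilityTheory
open scoped ENNReal Classical

/-- Kullback–Leibler divergence `KL(μ ‖ ν) = ∫ log (dμ/dν) dμ` when `μ ≪ ν`
(`+∞` if the integral diverges), `+∞` otherwise; valued in `[0,∞]` (for probability
measures the divergence is nonnegative). -/
noncomputable def klDiv {α : Type*} [MeasurableSpace α] (μ ν : Measure α) : ℝ≥0∞ :=
  if μ ≪ ν ∧ Integrable (fun x => Real.log ((μ.rnDeriv ν x).toReal)) μ
  then ENNReal.ofReal (∫ x, Real.log ((μ.rnDeriv ν x).toReal) ∂μ)
  else ⊤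

/-- The Jensen–Shannon divergence `JSD(μ, ν) = ½ KL(μ ‖ m) + ½ KL(ν ‖ m)` with
`m = ½ (μ + ν)`. -/
noncomputable def jsd {α : Type*} [MeasurableSpace α] (μ ν : Measure α) : ℝ≥0∞ :=
  2⁻¹ * klDiv μ ((2⁻¹ : ℝ≥0∞) • (μ + ν)) + 2⁻¹ * klDiv ν ((2⁻¹ : ℝ≥0∞) • (μ + ν))

open Real Set InformationTheory

/-- The pointwise inequality behind Pinsker's inequality. -/
lemma three_mul_sq_sub_one_le_klFun {t : ℝ} (ht : 0 ≤ t) :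
    3 * (t - 1) ^ 2 ≤ (2 * t + 4) * klFun t := by
  rcases ht.eq_or_lt with rfl | ht
  · norm_num [klFun_zero]
  let h : ℝ → ℝ := fun x => log x - (x - 1) * (5 * x + 1) / (2 * x * (x + 2))
  have hderiv : ∀ x : ℝ, 0 < x → HasDerivAt h ((x - 1) ^ 3 / (x ^ 2 * (x + 2) ^ 2)) x := by
    intro x hx
    have h1 : HasDerivAt (fun x : ℝ => (x - 1) * (5 * x + 1)) (10 * x - 4) x := by
      convert! ((hasDerivAt_id x).sub_const 1).mul
        (((hasDerivAt_id x).const_mul 5).add_const 1) using 1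
      simp only [id]
      ring
    have h2 : HasDerivAt (fun x : ℝ => 2 * x * (x + 2)) (4 * x + 4) x := by
      convert! ((hasDerivAt_id x).const_mul 2).mul ((hasDerivAt_id x).add_const 2) using 1
      simp only [id]
      ring
    convert! (hasDerivAt_log hx.ne').sub (h1.div h2 (by positivity)) using 1
    field_simp
    ring
  have hh : 0 ≤ h t := by
    have h1 : h 1 = 0 := by simp [h]
    rw [← h1]
    rcases le_total t 1 with ht1 | ht1
    · refine antitoneOn_of_deriv_nonpos (convex_Ioc 0 1)
        (fun x hx => (hderiv x hx.1).continuousAt.continuousWithinAt)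
        (fun x hx => (hderiv x ?_).differentiableAt.differentiableWithinAt)
        (fun x hx => ?_) (show t ∈ Ioc 0 1 from ⟨ht, ht1⟩) (by simp) ht1
      · exact (interior_subset hx).1
      · have hx' := interior_subset hx
        rw [(hderiv x hx'.1).deriv]
        refine div_nonpos_of_nonpos_of_nonneg ?_ (by positivity)
        exact Odd.pow_nonpos (by decide) (by linarith [hx'.2])
    · refine monotoneOn_of_deriv_nonneg (convex_Ici 1)
        (fun x hx => (hderiv x ?_).continuousAt.continuousWithinAt)
        (fun x hx => (hderiv x ?_).differentiableAt.differentiableWithinAt)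
        (fun x hx => ?_) (show (1 : ℝ) ∈ Ici 1 by simp) (show t ∈ Ici 1 from ht1) ht1
      · exact zero_lt_one.trans_le hx
      · exact zero_lt_one.trans_le (interior_subset hx)
      · have hx' : 1 ≤ x := interior_subset hx
        rw [(hderiv x (by linarith)).deriv]
        have : 0 ≤ x - 1 := by linarith
        positivity
  have key : klFun t * (2 * t + 4) - 3 * (t - 1) ^ 2 = h t * (t * (2 * t + 4)) := by
    simp only [h, klFun_apply]
    field_simp
    ring
  have : 0 ≤ h t * (t * (2 * t + 4)) := by positivity
  linarith

lemma klFun_le_abs_sub_one {t : ℝ} (h0 : 0 ≤ t) (h2 : t ≤ 2) : klFun t ≤ |t - 1| := by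
  have h1 : klFun t ≤ (t - 1) ^ 2 := by
    rcases h0.eq_or_lt with rfl | ht
    · norm_num [klFun_zero]
    · rw [klFun_apply]
      nlinarith [log_le_sub_one_of_pos ht]
  have h3 : |t - 1| ≤ 1 := abs_le.2 ⟨by linarith, by linarith⟩
  nlinarith [sq_abs (t - 1), abs_nonneg (t - 1)]

section Measure

variable {α : Type*} [MeasurableSpace α]

lemma klDiv_eq_informationTheory_klDiv (μ ν : Measure α) [IsProbabilityMeasure μ]
    [IsProbabilityMeasure ν] : _root_.klDiv μ ν = InformationTheory.klDiv μ ν := by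
  simp [_root_.klDiv, InformationTheory.klDiv_def, llr_def]

lemma klFin_eq_informationTheory_klDiv {K : ℕ} (μ ν : Measure (Fin K)) [IsProbabilityMeasure μ]
    [IsProbabilityMeasure ν] : klFin μ ν = InformationTheory.klDiv μ ν := by
  by_cases h : μ ≪ ν
  swap
  · simp [klFin, h]
  rw [klDiv_of_ac_of_integrable h .of_finite, integral_fintype .of_finite, klFin, if_pos h]
  simp only [probReal_univ, add_sub_cancel_right, smul_eq_mul]
  congr 1
  refine Finset.sum_congr rfl fun y _ => ?_
  have hy : μ {y} = μ.rnDeriv ν y * ν {y} := by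
    rw [← Measure.setLIntegral_rnDeriv h, lintegral_singleton]
  rw [measureReal_def]
  rcases eq_or_ne (μ {y}) 0 with h0 | h0
  · simp [h0]
  have hν : (ν {y}).toReal ≠ 0 :=
    ENNReal.toReal_ne_zero.2 ⟨fun hν => h0 (h hν), measure_ne_top _ _⟩
  rw [llr_def]
  congr 2
  rw [hy, ENNReal.toReal_mul, mul_div_cancel_right₀ _ hν]

lemma integrable_of_abs_le_one {μ : Measure α} [IsFiniteMeasure μ] {φ : α → ℝ}
    (hφ : Measurable φ) (hb : ∀ x, |φ x| ≤ 1) : Integrable φ μ :=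
  .of_bound hφ.aestronglyMeasurable 1 (.of_forall hb)

lemma lintegral_mul_le_sqrt_mul_sqrt (μ : Measure α) {f g : α → ℝ≥0∞} (hf : AEMeasurable f μ)
    (hg : AEMeasurable g μ) :
    ∫⁻ x, f x ^ (1 / 2 : ℝ) * g x ^ (1 / 2 : ℝ) ∂μ
      ≤ (∫⁻ x, f x ∂μ) ^ (1 / 2 : ℝ) * (∫⁻ x, g x ∂μ) ^ (1 / 2 : ℝ) := by
  have sq : ∀ a : ℝ≥0∞, (a ^ (1 / 2 : ℝ)) ^ (2 : ℝ) = a := fun a => by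
    rw [← ENNReal.rpow_mul]
    norm_num
  simpa only [sq, Pi.mul_apply] using ENNReal.lintegral_mul_le_Lp_mul_Lq μ Real.HolderConjugate.two_two
    (hf.pow_const (1 / 2 : ℝ)) (hg.pow_const (1 / 2 : ℝ))

lemma lintegral_sqrt_le_sqrt_lintegral (μ : Measure α) [IsProbabilityMeasure μ] {f : α → ℝ≥0∞}
    (hf : AEMeasurable f μ) :
    ∫⁻ x, f x ^ (1 / 2 : ℝ) ∂μ ≤ (∫⁻ x, f x ∂μ) ^ (1 / 2 : ℝ) := by
  simpa using lintegral_mul_le_sqrt_mul_sqrt μ hf (aemeasurable_const (b := (1 : ℝ≥0∞)))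

lemma integral_mul_rnDeriv_sub_one {μ ν : Measure α} [IsFiniteMeasure μ] [IsFiniteMeasure ν]
    (h : μ ≪ ν) {φ : α → ℝ} (hφ : Measurable φ) (hb : ∀ x, |φ x| ≤ 1) :
    ∫ x, φ x * ((μ.rnDeriv ν x).toReal - 1) ∂ν = ∫ x, φ x ∂μ - ∫ x, φ x ∂ν := by
  rw [← integral_toReal_rnDeriv_mul h,
    ← integral_sub _ (integrable_of_abs_le_one hφ hb)]
  · congr with x
    ring
  · exact Measure.integrable_toReal_rnDeriv.mul_bdd (c := 1) hφ.aestronglyMeasurable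
      (.of_forall hb)

/-- **Pinsker's inequality** in dual form. -/
lemma ofReal_integral_sub_le_sqrt_klDiv (μ ν : Measure α) [IsProbabilityMeasure μ]
    [IsProbabilityMeasure ν] {φ : α → ℝ} (hφ : Measurable φ) (hb : ∀ x, |φ x| ≤ 1) :
    ENNReal.ofReal (∫ x, φ x ∂μ - ∫ x, φ x ∂ν)
      ≤ (2 * InformationTheory.klDiv μ ν) ^ (1 / 2 : ℝ) := by
  by_cases h : μ ≪ ν
  swap
  · simp [h]
  have hint : Integrable (fun x => (μ.rnDeriv ν x).toReal) ν := Measure.integrable_toReal_rnDeriv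
  have hint1 : Integrable (fun x => (μ.rnDeriv ν x).toReal - 1) ν := hint.sub (integrable_const 1)
  have hmeas : Measurable fun x => (μ.rnDeriv ν x).toReal :=
    (Measure.measurable_rnDeriv μ ν).ennreal_toReal
  rw [klDiv_eq_lintegral_klFun_of_ac h, ENNReal.mul_rpow_of_nonneg _ _ (by norm_num)]
  calc ENNReal.ofReal (∫ x, φ x ∂μ - ∫ x, φ x ∂ν)
      ≤ ENNReal.ofReal (∫ x, |(μ.rnDeriv ν x).toReal - 1| ∂ν) := by
        rw [← integral_mul_rnDeriv_sub_one h hφ hb]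
        refine ENNReal.ofReal_le_ofReal (integral_mono ?_ hint1.abs fun x => ?_)
        · exact hint1.bdd_mul (c := 1) hφ.aestronglyMeasurable (.of_forall hb)
        · refine (le_abs_self _).trans ?_
          rw [abs_mul]
          exact mul_le_of_le_one_left (abs_nonneg _) (hb x)
    _ = ∫⁻ x, ENNReal.ofReal |(μ.rnDeriv ν x).toReal - 1| ∂ν :=
        ofReal_integral_eq_lintegral_ofReal hint1.abs (.of_forall fun _ => abs_nonneg _)
    _ ≤ ∫⁻ x, ENNReal.ofReal ((2 * (μ.rnDeriv ν x).toReal + 4) / 3) ^ (1 / 2 : ℝ)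
          * ENNReal.ofReal (klFun (μ.rnDeriv ν x).toReal) ^ (1 / 2 : ℝ) ∂ν := by
        refine lintegral_mono fun x => ?_
        have h0 : 0 ≤ (μ.rnDeriv ν x).toReal := ENNReal.toReal_nonneg
        have hk := klFun_nonneg h0
        rw [← ENNReal.mul_rpow_of_nonneg _ _ (by norm_num), ← ENNReal.ofReal_mul (by positivity),
          ENNReal.ofReal_rpow_of_nonneg (by positivity) (by norm_num), ← Real.sqrt_eq_rpow]
        refine ENNReal.ofReal_le_ofReal (Real.abs_le_sqrt ?_)
        linarith [three_mul_sq_sub_one_le_klFun h0]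
    _ ≤ (∫⁻ x, ENNReal.ofReal ((2 * (μ.rnDeriv ν x).toReal + 4) / 3) ∂ν) ^ (1 / 2 : ℝ)
          * (∫⁻ x, ENNReal.ofReal (klFun (μ.rnDeriv ν x).toReal) ∂ν) ^ (1 / 2 : ℝ) :=
        lintegral_mul_le_sqrt_mul_sqrt ν (by fun_prop)
          (measurable_klFun.comp hmeas).ennreal_ofReal.aemeasurable
    _ = _ := by
        congr 2
        rw [← ofReal_integral_eq_lintegral_ofReal]
        · rw [integral_div, integral_add (hint.const_mul 2) (integrable_const _),
            integral_const_mul, Measure.integral_toReal_rnDeriv h]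
          norm_num
        · exact ((hint.const_mul 2).add (integrable_const 4)).div_const 3
        · exact .of_forall fun x => by positivity

instance isProbabilityMeasure_half_smul_add (μ ν : Measure α) [IsProbabilityMeasure μ]
    [IsProbabilityMeasure ν] : IsProbabilityMeasure ((2⁻¹ : ℝ≥0∞) • (μ + ν)) := by
  constructor
  simp [ENNReal.inv_two_add_inv_two]

lemma integral_sub_integral_half_smul_add (μ ν : Measure α) [IsProbabilityMeasure μ]
    [IsProbabilityMeasure ν] {φ : α → ℝ} (hφ : Measurable φ) (hb : ∀ x, |φ x| ≤ 1) :
    ∫ x, φ x ∂μ - ∫ x, φ x ∂((2⁻¹ : ℝ≥0∞) • (μ + ν))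
      = 2⁻¹ * (∫ x, φ x ∂μ - ∫ x, φ x ∂ν) := by
  rw [integral_smul_measure, integral_add_measure (integrable_of_abs_le_one hφ hb)
    (integrable_of_abs_le_one hφ hb)]
  simp only [ENNReal.toReal_inv, ENNReal.toReal_ofNat, smul_eq_mul]
  ring

lemma absolutelyContinuous_half_smul_add (μ ν : Measure α) :
    μ ≪ (2⁻¹ : ℝ≥0∞) • (μ + ν) :=
  (Measure.absolutelyContinuous_of_le (Measure.le_add_right le_rfl)).trans
    (Measure.absolutelyContinuous_smul (by simp))

lemma rnDeriv_half_smul_add_le_two (μ ν : Measure α) [IsProbabilityMeasure μ]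
    [IsProbabilityMeasure ν] :
    ∀ᵐ x ∂((2⁻¹ : ℝ≥0∞) • (μ + ν)), μ.rnDeriv ((2⁻¹ : ℝ≥0∞) • (μ + ν)) x ≤ 2 := by
  refine ae_le_of_forall_setLIntegral_le_of_sigmaFinite (Measure.measurable_rnDeriv _ _)
    fun s hs _ => ?_
  refine (Measure.setLIntegral_rnDeriv_le s).trans ?_
  rw [setLIntegral_const, Measure.smul_apply, smul_eq_mul, ← mul_assoc,
    ENNReal.mul_inv_cancel (by simp) (by simp), one_mul, Measure.add_apply]
  exact le_self_add

lemma exists_klDiv_half_smul_add_le (μ ν : Measure α) [IsProbabilityMeasure μ]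
    [IsProbabilityMeasure ν] :
    ∃ φ : α → ℝ, Measurable φ ∧ (∀ x, |φ x| ≤ 1) ∧
      InformationTheory.klDiv μ ((2⁻¹ : ℝ≥0∞) • (μ + ν))
        ≤ ENNReal.ofReal (2⁻¹ * (∫ x, φ x ∂μ - ∫ x, φ x ∂ν)) := by
  have hac := absolutelyContinuous_half_smul_add μ ν
  have hf2 := rnDeriv_half_smul_add_le_two μ ν
  have hsub := fun φ => integral_sub_integral_half_smul_add μ ν (φ := φ)
  set m := (2⁻¹ : ℝ≥0∞) • (μ + ν) with hm
  have : IsProbabilityMeasure m := isProbabilityMeasure_half_smul_add μ ν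
  have hmeas : Measurable fun x => (μ.rnDeriv m x).toReal :=
    (Measure.measurable_rnDeriv μ m).ennreal_toReal
  have hint1 : Integrable (fun x => (μ.rnDeriv m x).toReal - 1) m :=
    Measure.integrable_toReal_rnDeriv.sub (integrable_const 1)
  let φ : α → ℝ := fun x => if 1 ≤ (μ.rnDeriv m x).toReal then 1 else -1
  have hφ : Measurable φ :=
    Measurable.ite (measurableSet_le measurable_const hmeas) measurable_const measurable_const
  have hb : ∀ x, |φ x| ≤ 1 := fun x => by
    simp only [φ]
    split_ifs <;> simp
  refine ⟨φ, hφ, hb, ?_⟩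
  rw [← hsub φ hφ hb, ← integral_mul_rnDeriv_sub_one hac hφ hb, klDiv_eq_lintegral_klFun_of_ac hac]
  have hφabs : ∀ x, φ x * ((μ.rnDeriv m x).toReal - 1) = |(μ.rnDeriv m x).toReal - 1| := by
    intro x
    simp only [φ]
    split_ifs with h
    · rw [abs_of_nonneg (by linarith), one_mul]
    · rw [abs_of_neg (by linarith), neg_one_mul]
  simp_rw [hφabs]
  rw [ofReal_integral_eq_lintegral_ofReal hint1.abs (.of_forall fun _ => abs_nonneg _)]
  refine lintegral_mono_ae ?_
  filter_upwards [hf2] with x hx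
  refine ENNReal.ofReal_le_ofReal (klFun_le_abs_sub_one ENNReal.toReal_nonneg ?_)
  simpa using ENNReal.toReal_mono (by simp) hx

lemma jsd_eq (μ ν : Measure α) [IsProbabilityMeasure μ] [IsProbabilityMeasure ν] :
    jsd μ ν = 2⁻¹ * InformationTheory.klDiv μ ((2⁻¹ : ℝ≥0∞) • (μ + ν))
      + 2⁻¹ * InformationTheory.klDiv ν ((2⁻¹ : ℝ≥0∞) • (ν + μ)) := by
  rw [jsd, klDiv_eq_informationTheory_klDiv, klDiv_eq_informationTheory_klDiv, add_comm ν μ]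

/-- The Jensen–Shannon divergence is bounded by the total variation distance, in dual form. -/
lemma jsd_le_of_forall_integral_sub_le (μ ν : Measure α) [IsProbabilityMeasure μ]
    [IsProbabilityMeasure ν] {C : ℝ≥0∞}
    (hC : ∀ φ : α → ℝ, Measurable φ → (∀ x, |φ x| ≤ 1) →
      ENNReal.ofReal (∫ x, φ x ∂μ - ∫ x, φ x ∂ν) ≤ C) :
    jsd μ ν ≤ 2⁻¹ * C := by
  have half : ∀ a : ℝ, ENNReal.ofReal (2⁻¹ * a) = 2⁻¹ * ENNReal.ofReal a := fun a => by
    rw [ENNReal.ofReal_mul (by norm_num), ENNReal.ofReal_inv_of_pos (by norm_num),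
      ENNReal.ofReal_ofNat]
  have h1 : InformationTheory.klDiv μ ((2⁻¹ : ℝ≥0∞) • (μ + ν)) ≤ 2⁻¹ * C := by
    obtain ⟨φ, hφ, hb, h⟩ := exists_klDiv_half_smul_add_le μ ν
    rw [half] at h
    exact h.trans (mul_le_mul_right (hC φ hφ hb) _)
  have h2 : InformationTheory.klDiv ν ((2⁻¹ : ℝ≥0∞) • (ν + μ)) ≤ 2⁻¹ * C := by
    obtain ⟨φ, hφ, hb, h⟩ := exists_klDiv_half_smul_add_le ν μ
    rw [half] at h
    have := hC (fun x => -φ x) hφ.neg (by simpa using hb)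
    rw [integral_neg, integral_neg, neg_sub_neg] at this
    exact h.trans (mul_le_mul_right this _)
  rw [jsd_eq]
  calc _ ≤ 2⁻¹ * (2⁻¹ * C) + 2⁻¹ * (2⁻¹ * C) := by gcongr
    _ = 2⁻¹ * C := by rw [← add_mul, ENNReal.inv_two_add_inv_two, one_mul]

/-- The total variation distance, in dual form, is bounded through the Jensen–Shannon divergence. -/
lemma ofReal_integral_sub_le_sqrt_jsd (μ ν : Measure α) [IsProbabilityMeasure μ]
    [IsProbabilityMeasure ν] {φ : α → ℝ} (hφ : Measurable φ) (hb : ∀ x, |φ x| ≤ 1) :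
    ENNReal.ofReal (∫ x, φ x ∂μ - ∫ x, φ x ∂ν) ≤ 2 * (2 * jsd μ ν) ^ (1 / 2 : ℝ) := by
  have double : ENNReal.ofReal (∫ x, φ x ∂μ - ∫ x, φ x ∂ν)
      = 2 * ENNReal.ofReal (2⁻¹ * (∫ x, φ x ∂μ - ∫ x, φ x ∂ν)) := by
    rw [← ENNReal.ofReal_ofNat, ← ENNReal.ofReal_mul (by norm_num)]
    congr 1
    ring
  have h1 := ofReal_integral_sub_le_sqrt_klDiv μ ((2⁻¹ : ℝ≥0∞) • (μ + ν)) hφ hb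
  have h2 := ofReal_integral_sub_le_sqrt_klDiv ν ((2⁻¹ : ℝ≥0∞) • (ν + μ)) hφ.neg
    (by simpa using hb)
  rw [integral_sub_integral_half_smul_add _ _ hφ hb] at h1
  rw [integral_sub_integral_half_smul_add _ _ hφ.neg (by simpa using hb)] at h2
  simp only [Pi.neg_apply, integral_neg, neg_sub_neg] at h2
  rw [double, jsd_eq]
  refine mul_le_mul_right ?_ _
  rcases le_total (InformationTheory.klDiv μ ((2⁻¹ : ℝ≥0∞) • (μ + ν)))
    (InformationTheory.klDiv ν ((2⁻¹ : ℝ≥0∞) • (ν + μ))) with h | h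
  · refine h1.trans (ENNReal.rpow_le_rpow (mul_le_mul_right ?_ _) (by norm_num))
    conv_lhs => rw [← one_mul (InformationTheory.klDiv _ _), ← ENNReal.inv_two_add_inv_two, add_mul]
    gcongr
  · refine h2.trans (ENNReal.rpow_le_rpow (mul_le_mul_right ?_ _) (by norm_num))
    conv_lhs => rw [← one_mul (InformationTheory.klDiv _ _), ← ENNReal.inv_two_add_inv_two, add_mul]
    gcongr

lemma measurable_klFin {K : ℕ} (κ η : Kernel α (Fin K)) :
    Measurable fun x => klFin (κ x) (η x) := by
  have hac : ∀ x, κ x ≪ η x ↔ ∀ y, η x {y} = 0 → κ x {y} = 0 := by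
    refine fun x => ⟨fun h y hy => h hy, fun h s hs => ?_⟩
    rw [← biUnion_of_singleton s]
    exact (measure_biUnion_null_iff s.to_countable).2
      fun y hy => h y (measure_mono_null (singleton_subset_iff.2 hy) hs)
  have hκ : ∀ y, Measurable fun x => κ x {y} := fun y => κ.measurable_coe (.singleton y)
  have hη : ∀ y, Measurable fun x => η x {y} := fun y => η.measurable_coe (.singleton y)
  unfold klFin
  refine Measurable.ite ?_ ?_ measurable_const
  · simp only [hac, ofPred_forall]
    refine .iInter fun y => ?_
    have : {x | η x {y} = 0 → κ x {y} = 0} = {x | η x {y} = 0}ᶜ ∪ {x | κ x {y} = 0} := by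
      ext x
      simp [imp_iff_not_or]
    rw [this]
    exact (hη y (.singleton 0)).compl.union (hκ y (.singleton 0))
  · fun_prop

lemma ofReal_integral_le_lintegral_ofReal {μ : Measure α} (f : α → ℝ) :
    ENNReal.ofReal (∫ x, f x ∂μ) ≤ ∫⁻ x, ENNReal.ofReal (f x) ∂μ := by
  by_cases hf : Integrable f μ
  · rw [integral_eq_lintegral_pos_part_sub_lintegral_neg_part hf]
    exact (ENNReal.ofReal_le_ofReal (sub_le_self _ ENNReal.toReal_nonneg)).trans
      ENNReal.ofReal_toReal_le
  · simp [integral_undef hf]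

/-- Averaged Pinsker inequality for kernels into a finite set, in dual form. -/
lemma ofReal_integral_integral_sub_le_sqrt_klFin {K : ℕ} (Q : Measure α) [IsProbabilityMeasure Q]
    (κ η : Kernel α (Fin K)) [IsMarkovKernel κ] [IsMarkovKernel η] {φ : α × Fin K → ℝ}
    (hb : ∀ z, |φ z| ≤ 1) (hφ : Measurable φ) :
    ENNReal.ofReal (∫ x, (∫ y, φ (x, y) ∂κ x - ∫ y, φ (x, y) ∂η x) ∂Q)
      ≤ (2 * ∫⁻ x, klFin (κ x) (η x) ∂Q) ^ (1 / 2 : ℝ) := by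
  have hm := measurable_klFin κ η
  calc _ ≤ ∫⁻ x, ENNReal.ofReal (∫ y, φ (x, y) ∂κ x - ∫ y, φ (x, y) ∂η x) ∂Q :=
        ofReal_integral_le_lintegral_ofReal _
    _ ≤ ∫⁻ x, (2 * klFin (κ x) (η x)) ^ (1 / 2 : ℝ) ∂Q := by
        refine lintegral_mono fun x => ?_
        rw [klFin_eq_informationTheory_klDiv]
        exact ofReal_integral_sub_le_sqrt_klDiv _ _ (by fun_prop) fun y => hb _
    _ ≤ _ := by
        rw [← lintegral_const_mul _ hm]
        exact lintegral_sqrt_le_sqrt_lintegral Q (hm.const_mul 2).aemeasurable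

lemma abs_integral_le_one (μ : Measure α) [IsProbabilityMeasure μ] {φ : α → ℝ}
    (hb : ∀ x, |φ x| ≤ 1) : |∫ x, φ x ∂μ| ≤ 1 := by
  simpa using
    norm_integral_le_of_norm_le_const (μ := μ) (f := φ) (C := 1) (.of_forall hb)

end Measure

/-- Theorem 1: for the real joint `P_XY = P_X ⊗ κ_P`, the generated joint
`Q_XY = Q_X ⊗ κ_Q`, and the two auxiliary classifiers' conditionals `κ_p`, `κ_q`,
`JSD(P_XY, Q_XY) ≤ 2 c₁ √(2 JSD(P_X, Q_X)) + c₂ √(2 E_{Q_X}[KL(κ_P ‖ κ_p)])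
 + c₂ √(2 E_{Q_X}[KL(κ_Q ‖ κ_q)]) + c₂ √(2 E_{Q_X}[KL(κ_q ‖ κ_p)])`,
where the constants `c₁ = c₂ = 1` suffice. -/
theorem jsd_joint_bound
    {X : Type*} [MeasurableSpace X] {K : ℕ}
    (P Q : Measure X) [IsProbabilityMeasure P] [IsProbabilityMeasure Q]
    (κP κQ κp κq : Kernel X (Fin K))
    [IsMarkovKernel κP] [IsMarkovKernel κQ] [IsMarkovKernel κp] [IsMarkovKernel κq]
    (c₁ c₂ : ℝ≥0∞) (hc₁ : c₁ = 1) (hc₂ : c₂ = 1) :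
    jsd (P ⊗ₘ κP) (Q ⊗ₘ κQ)
      ≤ 2 * c₁ * (2 * jsd P Q) ^ (1/2 : ℝ)
        + c₂ * (2 * ∫⁻ x, klFin (κP x) (κp x) ∂Q) ^ (1/2 : ℝ)
        + c₂ * (2 * ∫⁻ x, klFin (κQ x) (κq x) ∂Q) ^ (1/2 : ℝ)
        + c₂ * (2 * ∫⁻ x, klFin (κq x) (κp x) ∂Q) ^ (1/2 : ℝ) := by
  subst hc₁ hc₂
  simp only [one_mul, mul_one]
  set A := (2 * jsd P Q) ^ (1 / 2 : ℝ)
  set B₁ := (2 * ∫⁻ x, klFin (κP x) (κp x) ∂Q) ^ (1 / 2 : ℝ)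
  set B₂ := (2 * ∫⁻ x, klFin (κQ x) (κq x) ∂Q) ^ (1 / 2 : ℝ)
  set B₃ := (2 * ∫⁻ x, klFin (κq x) (κp x) ∂Q) ^ (1 / 2 : ℝ)
  have hC : jsd (P ⊗ₘ κP) (Q ⊗ₘ κQ) ≤ 2⁻¹ * (2 * A + B₁ + B₂ + B₃) := by
    refine jsd_le_of_forall_integral_sub_le _ _ fun φ hφ hb => ?_
    let Φ : Kernel X (Fin K) → X → ℝ := fun κ x => ∫ y, φ (x, y) ∂κ x
    have hΦb : ∀ (κ : Kernel X (Fin K)) [IsMarkovKernel κ] x, |Φ κ x| ≤ 1 :=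
      fun κ _ x => abs_integral_le_one _ fun y => hb _
    have hΦm : ∀ (κ : Kernel X (Fin K)) [IsMarkovKernel κ], Measurable (Φ κ) := fun κ _ =>
      (hφ.stronglyMeasurable.integral_kernel_prod_right' (κ := κ)).measurable
    have hΦi : ∀ (κ : Kernel X (Fin K)) [IsMarkovKernel κ], Integrable (Φ κ) Q := fun κ _ =>
      integrable_of_abs_le_one (hΦm κ) (hΦb κ)
    have hsub : ∀ (κ η : Kernel X (Fin K)) [IsMarkovKernel κ] [IsMarkovKernel η],
        ∫ x, (Φ κ x - Φ η x) ∂Q = ∫ x, Φ κ x ∂Q - ∫ x, Φ η x ∂Q := fun κ η _ _ =>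
      integral_sub (hΦi κ) (hΦi η)
    have h0 := ofReal_integral_sub_le_sqrt_jsd P Q (hΦm κP) (hΦb κP)
    have h1 := ofReal_integral_integral_sub_le_sqrt_klFin Q κP κp hb hφ
    have h2 := ofReal_integral_integral_sub_le_sqrt_klFin Q κQ κq (φ := fun z => -φ z)
      (by simpa using hb) hφ.neg
    have h3 := ofReal_integral_integral_sub_le_sqrt_klFin Q κq κp (φ := fun z => -φ z)
      (by simpa using hb) hφ.neg
    simp only [integral_neg, neg_sub_neg] at h2 h3
    rw [Measure.integral_compProd (integrable_of_abs_le_one hφ hb),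
      Measure.integral_compProd (integrable_of_abs_le_one hφ hb)]
    have key : ∫ x, Φ κP x ∂P - ∫ x, Φ κQ x ∂Q
        = (∫ x, Φ κP x ∂P - ∫ x, Φ κP x ∂Q) + ∫ x, (Φ κP x - Φ κp x) ∂Q
          + ∫ x, (Φ κq x - Φ κQ x) ∂Q + ∫ x, (Φ κp x - Φ κq x) ∂Q := by
      rw [hsub, hsub, hsub]
      ring
    rw [key]
    exact ENNReal.ofReal_add_le.trans (add_le_add (ENNReal.ofReal_add_le.trans
      (add_le_add (ENNReal.ofReal_add_le.trans (add_le_add h0 h1)) h2)) h3)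
  exact hC.trans (mul_le_of_le_one_left zero_le (by simp))
end
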